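/- arXiv:1301.6424 — 3 statements merged into one kernel-verified Lean document; each statement's English description precedes it below -/
import Mathlib

section
/- Let n ≥ 1. If there exists a Skolem sequence of order n, then n ≡ 0 (mod 4) or n ≡ 1 (mod 4). -/
/-- A Skolem sequence of order `n`: a sequence `s` indexed by positions `1, …, 2n`
such that every entry lies in `{1, …, n}`, every `k ∈ {1, …, n}` appears at exactly
two positions, and any two positions `i < j` carrying the same value `k` satisfy
`j - i = k`. -/
def IsSkolemSeq (n : ℕ) (s : ℕ → ℕ) : Prop :=
  (∀ i ∈ Finset.Icc 1 (2 * n), 1 ≤ s i ∧ s i ≤ n) ∧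
  (∀ k ∈ Finset.Icc 1 n, ((Finset.Icc 1 (2 * n)).filter (fun i => s i = k)).card = 2) ∧
  (∀ i ∈ Finset.Icc 1 (2 * n), ∀ j ∈ Finset.Icc 1 (2 * n), i < j → s i = s j → j - i = s i)

/-- The two positions of the value `k` in a Skolem sequence have a sum of the same parity as `k`. -/
theorem IsSkolemSeq.sum_fiber_modEq {n k : ℕ} {s : ℕ → ℕ} (hs : IsSkolemSeq n s)
    (hk : k ∈ Finset.Icc 1 n) :
    ∑ i ∈ (Finset.Icc 1 (2 * n)).filter (fun i => s i = k), i ≡ k [MOD 2] := by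
  obtain ⟨-, hcard, hdist⟩ := hs
  obtain ⟨i, j, hij, heq⟩ := Finset.card_eq_two.mp (hcard k hk)
  have hi : i ∈ (Finset.Icc 1 (2 * n)).filter (fun i => s i = k) := by simp [heq]
  have hj : j ∈ (Finset.Icc 1 (2 * n)).filter (fun i => s i = k) := by simp [heq]
  rw [Finset.mem_filter] at hi hj
  rw [heq, Finset.sum_pair hij, Nat.ModEq]
  rcases hij.lt_or_gt with hlt | hlt
  · have := hdist i hi.1 j hj.1 hlt (hi.2.trans hj.2.symm)
    omega
  · have := hdist j hj.1 i hi.1 hlt (hj.2.trans hi.2.symm)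
    omega

/-- In a Skolem sequence the sum of all positions has the same parity as the sum of all values. -/
theorem IsSkolemSeq.sum_positions_modEq {n : ℕ} {s : ℕ → ℕ} (hs : IsSkolemSeq n s) :
    ∑ i ∈ Finset.Icc 1 (2 * n), i ≡ ∑ k ∈ Finset.Icc 1 n, k [MOD 2] := by
  rw [← Finset.sum_fiberwise_of_maps_to (t := Finset.Icc 1 n)
    (fun i hi => Finset.mem_Icc.mpr (hs.1 i hi)), Nat.ModEq, Finset.sum_nat_mod,
    Finset.sum_nat_mod (Finset.Icc 1 n) 2 (fun k => k)]
  exact congrArg (· % 2) (Finset.sum_congr rfl fun k hk => hs.sum_fiber_modEq hk)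

/-- If a Skolem sequence of order `n ≥ 1` exists, then `n ≡ 0` or `1 (mod 4)`. -/
theorem skolem_necessary_condition (n : ℕ) (hn : 1 ≤ n)
    (h : ∃ s : ℕ → ℕ, IsSkolemSeq n s) :
    n % 4 = 0 ∨ n % 4 = 1 := by
  obtain ⟨s, hs⟩ := h
  have hpar := hs.sum_positions_modEq
  have hsum (m : ℕ) : (∑ k ∈ Finset.Icc 1 m, k) * 2 = m * (m + 1) := by
    induction m with
    | zero => simp
    | succ m ih => rw [Finset.sum_Icc_succ_top (by omega), add_mul, ih]; ring
  have hpos := hsum (2 * n)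
  have hval := hsum n
  unfold Nat.ModEq at hpar
  generalize ∑ k ∈ Finset.Icc 1 (2 * n), k = a at *
  generalize ∑ k ∈ Finset.Icc 1 n, k = b at *
  obtain ⟨q, r, hr, rfl⟩ : ∃ q r, r < 4 ∧ n = 4 * q + r :=
    ⟨n / 4, n % 4, Nat.mod_lt _ (by norm_num), (Nat.div_add_mod n 4).symm⟩
  ring_nf at hpos hval
  interval_cases r <;> omega
end

section
/- Let n ≥ 1 with n ≡ 0 (mod 4) or n ≡ 1 (mod 4). Then the number of Skolem sequences of order n is at least 2^⌊n/3⌋. -/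
/-- A Skolem sequence of order `n`, indexed by `Fin (2 * n)` (index `i` represents
position `i + 1`): every entry lies in `{1, …, n}`, every `k ∈ {1, …, n}` appears at
exactly two positions, and any two positions `i < j` carrying the same value `k`
satisfy `j - i = k`. -/
def IsSkolemSeqF (n : ℕ) (s : Fin (2 * n) → ℕ) : Prop :=
  (∀ i, 1 ≤ s i ∧ s i ≤ n) ∧
  (∀ k ∈ Finset.Icc 1 n, (Finset.univ.filter (fun i => s i = k)).card = 2) ∧
  (∀ i j : Fin (2 * n), i < j → s i = s j → (j : ℕ) - (i : ℕ) = s i)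

/-- `a d` is the (zero-based) first position of the value `d` in a Skolem sequence of order `n`;
the second position is `a d + d`. -/
structure IsSkolemStarts (n : ℕ) (a : ℕ → ℕ) : Prop where
  lt : ∀ d ∈ Finset.Icc 1 n, a d + d < 2 * n
  start_ne : ∀ d ∈ Finset.Icc 1 n, ∀ e ∈ Finset.Icc 1 n, d ≠ e → a d ≠ a e
  end_ne : ∀ d ∈ Finset.Icc 1 n, ∀ e ∈ Finset.Icc 1 n, d ≠ e → a d + d ≠ a e + e
  start_ne_end : ∀ d ∈ Finset.Icc 1 n, ∀ e ∈ Finset.Icc 1 n, a d ≠ a e + e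

namespace IsSkolemStarts

variable {n : ℕ} {a b : ℕ → ℕ}

/-- The position of the first (`false`) or second (`true`) occurrence of the value `k + 1`. -/
def position (ha : IsSkolemStarts n a) (x : Fin n × Bool) : Fin (2 * n) :=
  ⟨a (x.1 + 1) + if x.2 then (x.1 : ℕ) + 1 else 0, by
    have := ha.lt (x.1 + 1) (by simp)
    split <;> omega⟩

theorem position_bijective (ha : IsSkolemStarts n a) : Function.Bijective ha.position := by
  rw [Fintype.bijective_iff_injective_and_card]
  refine ⟨?_, by simp [mul_comm]⟩
  rintro ⟨k, x⟩ ⟨l, y⟩ h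
  have hk : (k : ℕ) + 1 ∈ Finset.Icc 1 n := by simp
  have hl : (l : ℕ) + 1 ∈ Finset.Icc 1 n := by simp
  have h1 := ha.start_ne _ hk _ hl
  have h2 := ha.end_ne _ hk _ hl
  have h3 := ha.start_ne_end _ hk _ hl
  have h4 := ha.start_ne_end _ hl _ hk
  simp only [position, Fin.mk.injEq] at h
  cases x <;> cases y <;> simp at h <;> simp [Fin.ext_iff] <;> omega

/-- The sequence whose occurrences of `d` are at the positions `a d` and `a d + d`. -/
noncomputable def toSeq (ha : IsSkolemStarts n a) (i : Fin (2 * n)) : ℕ :=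
  ((Equiv.ofBijective _ ha.position_bijective).symm i).1 + 1

theorem toSeq_position (ha : IsSkolemStarts n a) (x : Fin n × Bool) :
    ha.toSeq (ha.position x) = x.1 + 1 := by
  simp [toSeq, Equiv.ofBijective_symm_apply_apply]

theorem isSkolemSeqF_toSeq (ha : IsSkolemStarts n a) : IsSkolemSeqF n ha.toSeq := by
  refine ⟨fun i => ?_, fun k hk => ?_, fun i j hij h => ?_⟩
  · obtain ⟨x, rfl⟩ := ha.position_bijective.2 i
    rw [toSeq_position]
    omega
  · obtain ⟨k, rfl⟩ : ∃ l, k = l + 1 := ⟨k - 1, by simp at hk; omega⟩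
    have hk' : k < n := by simp at hk; omega
    have : (Finset.univ.filter fun i => ha.toSeq i = k + 1) =
        (Finset.univ.image fun x => ha.position (⟨k, hk'⟩, x)) := by
      ext i
      obtain ⟨⟨l, x⟩, rfl⟩ := ha.position_bijective.2 i
      simp only [Finset.mem_filter, Finset.mem_univ, true_and, toSeq_position, Finset.mem_image,
        ha.position_bijective.1.eq_iff, Prod.mk.injEq, exists_eq_right, Fin.ext_iff]
      omega
    rw [this, Finset.card_image_of_injective _ fun x y hxy => by
      simpa using ha.position_bijective.1 hxy]
    simp
  · obtain ⟨⟨k, x⟩, rfl⟩ := ha.position_bijective.2 i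
    obtain ⟨⟨l, y⟩, rfl⟩ := ha.position_bijective.2 j
    simp only [toSeq_position, add_left_inj, Fin.val_inj] at h ⊢
    subst h
    cases x <;> cases y <;> simp [position, Fin.lt_def] at hij ⊢

theorem eq_of_toSeq_eq (ha : IsSkolemStarts n a) (hb : IsSkolemStarts n b)
    (h : ha.toSeq = hb.toSeq) : ∀ d ∈ Finset.Icc 1 n, a d = b d := by
  intro d hd
  obtain ⟨k, rfl⟩ : ∃ l, d = l + 1 := ⟨d - 1, by simp at hd; omega⟩
  have hk : k < n := by simp at hd; omega
  have key : ∀ x, ∃ y, hb.position (⟨k, hk⟩, x) = ha.position (⟨k, hk⟩, y) := by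
    intro x
    obtain ⟨⟨l, y⟩, hy⟩ := ha.position_bijective.2 (hb.position (⟨k, hk⟩, x))
    have := hb.toSeq_position (⟨k, hk⟩, x)
    rw [← h, ← hy, toSeq_position] at this
    obtain rfl : l = ⟨k, hk⟩ := by ext; simpa using this
    exact ⟨y, hy.symm⟩
  obtain ⟨y, hy⟩ := key false
  obtain ⟨z, hz⟩ := key true
  simp only [position, Fin.mk.injEq] at hy hz
  cases y <;> cases z <;> simp at hy hz <;> omega

end IsSkolemStarts

instance (n : ℕ) : Finite {s : Fin (2 * n) → ℕ // IsSkolemSeqF n s} :=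
  Finite.of_injective (β := Fin (2 * n) → Fin (n + 1))
    (fun s i => ⟨s.1 i, Nat.lt_succ_of_le (s.2.1 i).2⟩) fun s t h => by
      ext i
      simpa using congrFun h i

theorem card_le_card_isSkolemSeqF {n : ℕ} {ι : Type} (f : ι → ℕ → ℕ)
    (hf : ∀ i, IsSkolemStarts n (f i))
    (hinj : ∀ i j, (∀ d ∈ Finset.Icc 1 n, f i d = f j d) → i = j) :
    Nat.card ι ≤ Nat.card {s : Fin (2 * n) → ℕ // IsSkolemSeqF n s} :=
  Nat.card_le_card_of_injective (fun i => ⟨(hf i).toSeq, (hf i).isSkolemSeqF_toSeq⟩)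
    fun i j h => hinj i j ((hf i).eq_of_toSeq_eq (hf j) (congrArg Subtype.val h))

/-- The number of cuts `p, q, q, p + t, r, s, s + 3, r + t + 3` that are at most `x`. -/
def cutsBelow (t p q r s x : ℕ) : ℕ :=
  if x < p then 0 else if x < q then 1 else if x < p + t then 3 else if x < r then 4 else
    if x < s then 5 else if x < s + 3 then 6 else if x < r + t + 3 then 7 else 8

/-- The number of cuts that have to lie between the two occurrences of the value `d`. -/
def cutsBetween (t d : ℕ) : ℕ :=
  if d ≤ 1 then 0 else if d ≤ t + 1 then 2 else 4

/-- A Skolem sequence of order `n` that can be extended to order `n + 12` by inserting a block of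
three positions at each of the eight cuts. -/
structure IsExtendable (n t p q r s : ℕ) (a : ℕ → ℕ) : Prop extends IsSkolemStarts n a where
  cuts : ∀ d ∈ Finset.Icc 1 n, cutsBelow t p q r s (a d + d) =
    cutsBelow t p q r s (a d) + cutsBetween t d

/-- The conditions on the cuts that are needed for the extension. -/
structure IsCutSystem (n t p q r s : ℕ) : Prop where
  one_le : 1 ≤ t
  le_order : t + 1 ≤ n
  p_le_q : p ≤ q
  q_le : q ≤ p + t
  le_r : p + t ≤ r
  r_le_s : r ≤ s
  s_le : s ≤ r + t
  le_two_mul : r + t + 3 ≤ 2 * n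

/-- The new place of the position `x`. -/
def shift (t p q r s x : ℕ) : ℕ := x + 3 * cutsBelow t p q r s x

/-- The place within the first of two blocks at distance `c` of the first occurrence of the value
`d`, where `d` is one of `c - 1`, `c`, `c + 1`. -/
def blockOffset (c : ℕ) (b : Bool) (d : ℕ) : ℕ :=
  if d = c then (if b then 0 else 2) else if d = c + 1 then (if b then 1 else 0) else
    (if b then 2 else 1)

/-- The extension of the starts `a` to order `n + 12` determined by four binary choices. -/
def extend (t p q r s : ℕ) (a : ℕ → ℕ) (b : Fin 4 → Bool) (d : ℕ) : ℕ :=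
  if d ≤ 1 then shift t p q r s (a d) else
  if d ≤ 4 then q + 3 + blockOffset 3 (b 0) d else
  if d ≤ 7 then s + 15 + blockOffset 6 (b 1) d else
  if d ≤ t + 7 then shift t p q r s (a (d - 6)) else
  if d ≤ t + 10 then p + blockOffset (t + 9) (b 2) d else
  if d ≤ t + 13 then r + 12 + blockOffset (t + 12) (b 3) d else
  shift t p q r s (a (d - 12))

section Extension

variable {n t p q r s : ℕ} {a : ℕ → ℕ}

theorem IsCutSystem.extend (h : IsCutSystem n t p q r s) :
    IsCutSystem (n + 12) (t + 6) (p + 3) (q + 6) (r + 15) (s + 18) := by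
  obtain ⟨h1, h2, h3, h4, h5, h6, h7, h8⟩ := h
  constructor <;> omega

theorem IsCutSystem.cutsBelow_cases (h : IsCutSystem n t p q r s) (x : ℕ) :
    (x < p ∧ cutsBelow t p q r s x = 0) ∨ (p ≤ x ∧ x < q ∧ cutsBelow t p q r s x = 1) ∨
    (q ≤ x ∧ x < p + t ∧ cutsBelow t p q r s x = 3) ∨
    (p + t ≤ x ∧ x < r ∧ cutsBelow t p q r s x = 4) ∨
    (r ≤ x ∧ x < s ∧ cutsBelow t p q r s x = 5) ∨
    (s ≤ x ∧ x < s + 3 ∧ cutsBelow t p q r s x = 6) ∨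
    (s + 3 ≤ x ∧ x < r + t + 3 ∧ cutsBelow t p q r s x = 7) ∨
    (r + t + 3 ≤ x ∧ cutsBelow t p q r s x = 8) := by
  obtain ⟨h1, h2, h3, h4, h5, h6, h7, h8⟩ := h
  unfold cutsBelow
  split_ifs <;> omega

theorem IsCutSystem.cutsBelow_mono (h : IsCutSystem n t p q r s) {x y : ℕ} (hxy : x ≤ y) :
    cutsBelow t p q r s x ≤ cutsBelow t p q r s y := by
  have hx := h.cutsBelow_cases x
  have hy := h.cutsBelow_cases y
  obtain ⟨h1, h2, h3, h4, h5, h6, h7, h8⟩ := h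
  generalize cutsBelow t p q r s x = k at *
  generalize cutsBelow t p q r s y = l at *
  rcases hx with hx | hx | hx | hx | hx | hx | hx | hx <;> omega

theorem IsCutSystem.shift_strictMono (h : IsCutSystem n t p q r s) :
    StrictMono (shift t p q r s) := by
  intro x y hxy
  have := h.cutsBelow_mono hxy.le
  unfold shift
  omega

/-- Shifted positions avoid the eight inserted blocks. -/
theorem IsCutSystem.shift_avoids (h : IsCutSystem n t p q r s) (x : ℕ) :
    (shift t p q r s x < p ∨ p + 3 ≤ shift t p q r s x) ∧
    (shift t p q r s x < q + 3 ∨ q + 9 ≤ shift t p q r s x) ∧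
    (shift t p q r s x < p + t + 9 ∨ p + t + 12 ≤ shift t p q r s x) ∧
    (shift t p q r s x < r + 12 ∨ r + 15 ≤ shift t p q r s x) ∧
    (shift t p q r s x < s + 15 ∨ s + 18 ≤ shift t p q r s x) ∧
    (shift t p q r s x < s + 21 ∨ s + 24 ≤ shift t p q r s x) ∧
    (shift t p q r s x < r + t + 24 ∨ r + t + 27 ≤ shift t p q r s x) := by
  obtain ⟨h1, h2, h3, h4, h5, h6, h7, h8⟩ := h
  unfold shift cutsBelow
  split_ifs <;> omega

theorem IsCutSystem.cutsBelow_shift (h : IsCutSystem n t p q r s) (x : ℕ) :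
    cutsBelow (t + 6) (p + 3) (q + 6) (r + 15) (s + 18) (shift t p q r s x) =
      cutsBelow t p q r s x := by
  have hy := h.extend.cutsBelow_cases (shift t p q r s x)
  have hx := h.cutsBelow_cases x
  obtain ⟨h1, h2, h3, h4, h5, h6, h7, h8⟩ := h
  have hxy : shift t p q r s x = x + 3 * cutsBelow t p q r s x := rfl
  generalize cutsBelow t p q r s x = k at *
  generalize cutsBelow (t + 6) (p + 3) (q + 6) (r + 15) (s + 18) (shift t p q r s x) = l at *
  rcases hx with hx | hx | hx | hx | hx | hx | hx | hx <;> omega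

theorem blockOffset_le (c : ℕ) (b : Bool) (d : ℕ) : blockOffset c b d ≤ 2 := by
  unfold blockOffset
  split_ifs <;> omega

theorem blockOffset_end {c : ℕ} (b : Bool) {d : ℕ} (h1 : c ≤ d + 1) (h2 : d ≤ c + 1) :
    c ≤ blockOffset c b d + d ∧ blockOffset c b d + d ≤ c + 2 := by
  unfold blockOffset
  split_ifs <;> omega

theorem blockOffset_ne {c : ℕ} (b : Bool) {d e : ℕ} (h1 : c ≤ d + 1) (h2 : d ≤ c + 1)
    (h3 : c ≤ e + 1) (h4 : e ≤ c + 1) (hde : d ≠ e) :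
    blockOffset c b d ≠ blockOffset c b e ∧ blockOffset c b d + d ≠ blockOffset c b e + e := by
  unfold blockOffset
  split_ifs <;> omega

/-- The triples `(x, u, c)` for which the blocks of length three starting at `u` and `u + c` carry the
values `c - 1`, `c`, `c + 1`, in the order given by the `x`-th choice. -/
def IsBlockPair (t p q r s : ℕ) (x : Fin 4) (u c : ℕ) : Prop :=
  (x = 0 ∧ u = q + 3 ∧ c = 3) ∨ (x = 1 ∧ u = s + 15 ∧ c = 6) ∨
    (x = 2 ∧ u = p ∧ c = t + 9) ∨ (x = 3 ∧ u = r + 12 ∧ c = t + 12)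

/-- The value of the extension that corresponds to the old value `e`. -/
def newValue (t e : ℕ) : ℕ :=
  if e ≤ 1 then e else if e ≤ t + 1 then e + 6 else e + 12

theorem extend_newValue (h : IsCutSystem n t p q r s) (b : Fin 4 → Bool) (e : ℕ) :
    extend t p q r s a b (newValue t e) = shift t p q r s (a e) := by
  have := h.one_le
  unfold newValue
  split_ifs with h1 h2
  · simp [extend, h1]
  · have h1' : ¬ e + 6 ≤ 1 := by omega
    have h2' : ¬ e + 6 ≤ 4 := by omega
    have h3' : ¬ e + 6 ≤ 7 := by omega
    have h4' : e + 6 ≤ t + 7 := by omega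
    simp [extend, h1', h2', h3', h4']
  · have h1' : ¬ e + 12 ≤ 1 := by omega
    have h2' : ¬ e + 12 ≤ 4 := by omega
    have h3' : ¬ e + 12 ≤ 7 := by omega
    have h4' : ¬ e + 12 ≤ t + 7 := by omega
    have h5' : ¬ e + 12 ≤ t + 10 := by omega
    have h6' : ¬ e + 12 ≤ t + 13 := by omega
    simp only [extend, h1', h2', h3', h4', h5', h6', if_false]
    simp

theorem newValue_cases (h : IsCutSystem n t p q r s) (a : ℕ → ℕ) (b : Fin 4 → Bool) {d : ℕ}
    (hd : d ∈ Finset.Icc 1 (n + 12)) :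
    (∃ e ∈ Finset.Icc 1 n, d = newValue t e) ∨
    ∃ x u c, IsBlockPair t p q r s x u c ∧ c ≤ d + 1 ∧ d ≤ c + 1 ∧
      extend t p q r s a b d = u + blockOffset c (b x) d := by
  have := h.one_le
  have := h.le_order
  simp only [Finset.mem_Icc] at hd
  by_cases h1 : d ≤ 1
  · refine .inl ⟨d, ?_, ?_⟩
    · simp; omega
    · simp [newValue, h1]
  by_cases h2 : d ≤ 4
  · exact .inr ⟨0, q + 3, 3, by simp [IsBlockPair], by omega, by omega, by
      simp [extend, h1, h2]⟩
  by_cases h3 : d ≤ 7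
  · exact .inr ⟨1, s + 15, 6, by simp [IsBlockPair], by omega, by omega, by
      simp [extend, h1, h2, h3]⟩
  by_cases h4 : d ≤ t + 7
  · refine .inl ⟨d - 6, ?_, ?_⟩
    · simp; omega
    · unfold newValue; split_ifs <;> omega
  by_cases h5 : d ≤ t + 10
  · exact .inr ⟨2, p, t + 9, by simp [IsBlockPair], by omega, by omega, by
      simp only [extend, h1, h2, h3, h4, h5, if_true, if_false]⟩
  by_cases h6 : d ≤ t + 13
  · exact .inr ⟨3, r + 12, t + 12, by simp [IsBlockPair], by omega, by omega, by
      simp only [extend, h1, h2, h3, h4, h5, h6, if_true, if_false]⟩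
  · refine .inl ⟨d - 12, ?_, ?_⟩
    · simp; omega
    · unfold newValue; split_ifs <;> omega

theorem IsBlockPair.shift_ne {x : Fin 4} {u c : ℕ} (hu : IsBlockPair t p q r s x u c)
    (h : IsCutSystem n t p q r s) (z : ℕ) {y : ℕ} (hy : y ≤ 2) :
    shift t p q r s z ≠ u + y ∧ shift t p q r s z ≠ u + c + y := by
  have hz := h.shift_avoids z
  obtain ⟨h1, h2, h3, h4, h5, h6, h7, h8⟩ := h
  rcases hu with ⟨-, rfl, rfl⟩ | ⟨-, rfl, rfl⟩ | ⟨-, rfl, rfl⟩ | ⟨-, rfl, rfl⟩ <;> omega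

theorem IsBlockPair.cutsBelow_add {x : Fin 4} {u c : ℕ} (hu : IsBlockPair t p q r s x u c)
    (h : IsCutSystem n t p q r s) {y z d : ℕ} (hy : y ≤ 2) (hz : z ≤ 2) (h1 : c ≤ d + 1)
    (h2 : d ≤ c + 1) :
    cutsBelow (t + 6) (p + 3) (q + 6) (r + 15) (s + 18) (u + c + z) =
      cutsBelow (t + 6) (p + 3) (q + 6) (r + 15) (s + 18) (u + y) + cutsBetween (t + 6) d := by
  have hy' := h.extend.cutsBelow_cases (u + y)
  have hz' := h.extend.cutsBelow_cases (u + c + z)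
  have hd : d ≤ 1 ∧ cutsBetween (t + 6) d = 0 ∨ 1 < d ∧ d ≤ t + 7 ∧ cutsBetween (t + 6) d = 2 ∨
      t + 7 < d ∧ cutsBetween (t + 6) d = 4 := by
    unfold cutsBetween
    split_ifs <;> omega
  obtain ⟨h1, h2, h3, h4, h5, h6, h7, h8⟩ := h
  generalize cutsBelow (t + 6) (p + 3) (q + 6) (r + 15) (s + 18) (u + y) = k at *
  generalize cutsBelow (t + 6) (p + 3) (q + 6) (r + 15) (s + 18) (u + c + z) = l at *
  rcases hu with ⟨-, rfl, rfl⟩ | ⟨-, rfl, rfl⟩ | ⟨-, rfl, rfl⟩ | ⟨-, rfl, rfl⟩ <;> omega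

theorem IsBlockPair.ne_or_eq {x x' : Fin 4} {u c u' c' : ℕ} (hu : IsBlockPair t p q r s x u c)
    (hu' : IsBlockPair t p q r s x' u' c') (h : IsCutSystem n t p q r s) {y y' : ℕ} (hy : y ≤ 2)
    (hy' : y' ≤ 2) :
    u + y ≠ u' + c' + y' ∧
      (x = x' ∧ u = u' ∧ c = c' ∨ u + y ≠ u' + y' ∧ u + c + y ≠ u' + c' + y') := by
  obtain ⟨h1, h2, h3, h4, h5, h6, h7, h8⟩ := h
  rcases hu with ⟨rfl, rfl, rfl⟩ | ⟨rfl, rfl, rfl⟩ | ⟨rfl, rfl, rfl⟩ | ⟨rfl, rfl, rfl⟩ <;>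
  rcases hu' with ⟨rfl, rfl, rfl⟩ | ⟨rfl, rfl, rfl⟩ | ⟨rfl, rfl, rfl⟩ | ⟨rfl, rfl, rfl⟩ <;>
  refine ⟨by omega, ?_⟩ <;> first | exact .inl ⟨rfl, rfl, rfl⟩ | exact .inr ⟨by omega, by omega⟩

theorem newValue_eq (t e : ℕ) : newValue t e = e + 3 * cutsBetween t e := by
  unfold newValue cutsBetween
  split_ifs <;> omega

theorem cutsBetween_newValue (t e : ℕ) :
    cutsBetween (t + 6) (newValue t e) = cutsBetween t e := by
  unfold newValue cutsBetween
  split_ifs <;> omega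

theorem newValue_le {e : ℕ} (he : e ≤ n) : newValue t e ≤ n + 12 := by
  unfold newValue
  split_ifs <;> omega

theorem le_newValue (t e : ℕ) : e ≤ newValue t e := by
  rw [newValue_eq]
  omega

theorem extend_newValue_add (h : IsCutSystem n t p q r s) (ha : IsExtendable n t p q r s a)
    (b : Fin 4 → Bool) {e : ℕ} (he : e ∈ Finset.Icc 1 n) :
    extend t p q r s a b (newValue t e) + newValue t e = shift t p q r s (a e + e) := by
  rw [extend_newValue h, newValue_eq, shift, shift, ha.cuts e he]
  ring

theorem exists_blockOffset_add {c d : ℕ} (u : ℕ) (b : Bool) (h1 : c ≤ d + 1) (h2 : d ≤ c + 1) :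
    ∃ z ≤ 2, u + blockOffset c b d + d = u + c + z :=
  ⟨blockOffset c b d + d - c, by have := blockOffset_end b h1 h2; omega,
    by have := blockOffset_end b h1 h2; omega⟩

theorem isExtendable_extend (h : IsCutSystem n t p q r s) (ha : IsExtendable n t p q r s a)
    (b : Fin 4 → Bool) :
    IsExtendable (n + 12) (t + 6) (p + 3) (q + 6) (r + 15) (s + 18)
      (extend t p q r s a b) where
  lt d hd := by
    rcases newValue_cases h a b hd with ⟨e, he, rfl⟩ | ⟨x, u, c, hu, h1, h2, h3⟩
    · rw [extend_newValue_add h ha b he]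
      have := ha.lt e he
      have : cutsBelow t p q r s (a e + e) ≤ 8 := by
        unfold cutsBelow
        split_ifs <;> omega
      unfold shift
      omega
    · obtain ⟨z, hz, hz'⟩ := exists_blockOffset_add u (b x) h1 h2
      rw [h3, hz']
      obtain ⟨h1, h2, h3, h4, h5, h6, h7, h8⟩ := h
      rcases hu with ⟨-, rfl, rfl⟩ | ⟨-, rfl, rfl⟩ | ⟨-, rfl, rfl⟩ | ⟨-, rfl, rfl⟩ <;> omega
  start_ne d hd d' hd' hne := by
    rcases newValue_cases h a b hd with ⟨e, he, rfl⟩ | ⟨x, u, c, hu, h1, h2, h3⟩ <;>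
    rcases newValue_cases h a b hd' with ⟨e', he', rfl⟩ | ⟨x', u', c', hu', h1', h2', h3'⟩
    · rw [extend_newValue h, extend_newValue h, h.shift_strictMono.injective.ne_iff]
      exact ha.start_ne e he e' he' fun hee => hne (hee ▸ rfl)
    · rw [extend_newValue h, h3']
      exact (hu'.shift_ne h _ (blockOffset_le _ _ _)).1
    · rw [extend_newValue h, h3]
      exact (hu.shift_ne h _ (blockOffset_le _ _ _)).1.symm
    · rw [h3, h3']
      obtain ⟨rfl, rfl, rfl⟩ | hne' := (hu.ne_or_eq hu' h (blockOffset_le c (b x) d)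
        (blockOffset_le c' (b x') d')).2
      · simpa using (blockOffset_ne (b x) h1 h2 h1' h2' hne).1
      · exact hne'.1
  end_ne d hd d' hd' hne := by
    rcases newValue_cases h a b hd with ⟨e, he, rfl⟩ | ⟨x, u, c, hu, h1, h2, h3⟩ <;>
    rcases newValue_cases h a b hd' with ⟨e', he', rfl⟩ | ⟨x', u', c', hu', h1', h2', h3'⟩
    · rw [extend_newValue_add h ha b he, extend_newValue_add h ha b he',
        h.shift_strictMono.injective.ne_iff]
      exact ha.end_ne e he e' he' fun hee => hne (hee ▸ rfl)
    · obtain ⟨z, hz, hz'⟩ := exists_blockOffset_add u' (b x') h1' h2'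
      rw [extend_newValue_add h ha b he, h3', hz']
      exact (hu'.shift_ne h _ hz).2
    · obtain ⟨z, hz, hz'⟩ := exists_blockOffset_add u (b x) h1 h2
      rw [extend_newValue_add h ha b he', h3, hz']
      exact (hu.shift_ne h _ hz).2.symm
    · obtain ⟨z, hz, hz'⟩ := exists_blockOffset_add u (b x) h1 h2
      obtain ⟨w, hw, hw'⟩ := exists_blockOffset_add u' (b x') h1' h2'
      obtain ⟨rfl, rfl, rfl⟩ | hne' := (hu.ne_or_eq hu' h hz hw).2
      · have := (blockOffset_ne (b x) h1 h2 h1' h2' hne).2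
        omega
      · rw [h3, h3', hz', hw']
        exact hne'.2
  start_ne_end d hd d' hd' := by
    rcases newValue_cases h a b hd with ⟨e, he, rfl⟩ | ⟨x, u, c, hu, h1, h2, h3⟩ <;>
    rcases newValue_cases h a b hd' with ⟨e', he', rfl⟩ | ⟨x', u', c', hu', h1', h2', h3'⟩
    · rw [extend_newValue h, extend_newValue_add h ha b he', h.shift_strictMono.injective.ne_iff]
      exact ha.start_ne_end e he e' he'
    · obtain ⟨z, hz, hz'⟩ := exists_blockOffset_add u' (b x') h1' h2'
      rw [extend_newValue h, h3', hz']
      exact (hu'.shift_ne h _ hz).2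
    · rw [extend_newValue_add h ha b he', h3]
      exact (hu.shift_ne h _ (blockOffset_le _ _ _)).1.symm
    · obtain ⟨w, hw, hw'⟩ := exists_blockOffset_add u' (b x') h1' h2'
      rw [h3, h3', hw']
      exact (hu.ne_or_eq hu' h (blockOffset_le c (b x) d) hw).1
  cuts d hd := by
    rcases newValue_cases h a b hd with ⟨e, he, rfl⟩ | ⟨x, u, c, hu, h1, h2, h3⟩
    · rw [extend_newValue_add h ha b he, extend_newValue h, h.cutsBelow_shift, h.cutsBelow_shift,
        cutsBetween_newValue, ha.cuts e he]
    · obtain ⟨z, hz, hz'⟩ := exists_blockOffset_add u (b x) h1 h2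
      rw [h3, hz']
      exact hu.cutsBelow_add h (blockOffset_le _ _ _) hz h1 h2

theorem extend_injective (h : IsCutSystem n t p q r s) {a a' : ℕ → ℕ} {b b' : Fin 4 → Bool}
    (heq : ∀ d ∈ Finset.Icc 1 (n + 12),
      extend t p q r s a b d = extend t p q r s a' b' d) :
    (∀ e ∈ Finset.Icc 1 n, a e = a' e) ∧ b = b' := by
  have hle := h.le_order
  have hone := h.one_le
  refine ⟨fun e he => ?_, ?_⟩
  · simp only [Finset.mem_Icc] at he
    have := heq (newValue t e) (by
      have := newValue_le (t := t) he.2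
      have := le_newValue t e
      simp; omega)
    rw [extend_newValue h, extend_newValue h] at this
    exact h.shift_strictMono.injective this
  · have h0 := heq 3 (by simp)
    have h1 := heq 6 (by simp)
    have h2 := heq (t + 9) (by simp; omega)
    have h3 := heq (t + 12) (by simp; omega)
    funext x
    fin_cases x
    · simp [extend, blockOffset] at h0
      grind
    · simp [extend, blockOffset] at h1
      grind
    · simp [extend, blockOffset] at h2
      grind
    · simp [extend, blockOffset] at h3
      grind

end Extension

/-- There are `N` extendable Skolem sequences of order `n` with the given cuts. -/
def HasExtendableFamily (n t p q r s N : ℕ) : Prop :=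
  IsCutSystem n t p q r s ∧ ∃ (ι : Type) (f : ι → ℕ → ℕ), Nat.card ι = N ∧
    (∀ i, IsExtendable n t p q r s (f i)) ∧
    ∀ i j, (∀ d ∈ Finset.Icc 1 n, f i d = f j d) → i = j

namespace HasExtendableFamily

variable {n t p q r s N : ℕ}

theorem extend (h : HasExtendableFamily n t p q r s N) :
    HasExtendableFamily (n + 12) (t + 6) (p + 3) (q + 6) (r + 15) (s + 18) (N * 16) := by
  obtain ⟨hcut, ι, f, hN, hf, hinj⟩ := h
  refine ⟨hcut.extend, ι × (Fin 4 → Bool), fun i => _root_.extend t p q r s (f i.1) i.2, ?_,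
    fun i => isExtendable_extend hcut (hf i.1) i.2, fun i j hij => ?_⟩
  · simp [hN]
  · obtain ⟨h1, h2⟩ := extend_injective hcut hij
    exact Prod.ext (hinj _ _ h1) h2

theorem extend_iterate (h : HasExtendableFamily n t p q r s N) (k : ℕ) :
    HasExtendableFamily (n + 12 * k) (t + 6 * k) (p + 3 * k) (q + 6 * k) (r + 15 * k)
      (s + 18 * k) (N * 16 ^ k) := by
  induction k with
  | zero => simpa using h
  | succ k ih => simpa [pow_succ, mul_add, add_assoc, mul_assoc] using ih.extend

theorem le_card (h : HasExtendableFamily n t p q r s N) :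
    N ≤ Nat.card {s : Fin (2 * n) → ℕ // IsSkolemSeqF n s} := by
  obtain ⟨-, ι, f, rfl, hf, hinj⟩ := h
  exact card_le_card_isSkolemSeqF f (fun i => (hf i).toIsSkolemStarts) hinj

end HasExtendableFamily

/-- The starts given by the list `l`, whose entry with index `k` belongs to the value `k + 1`. -/
def startsOfList (l : List ℕ) (d : ℕ) : ℕ := l.getD (d - 1) 0

theorem eq_of_startsOfList_eq {n : ℕ} {l m : List ℕ} (hl : l.length = n) (hm : m.length = n)
    (h : ∀ d ∈ Finset.Icc 1 n, startsOfList l d = startsOfList m d) : l = m := by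
  refine List.ext_getElem (hl.trans hm.symm) fun i hi hi' => ?_
  simpa [startsOfList, hi, hi'] using h (i + 1) (by simp; omega)

theorem eq_of_startsOfList_getElem_eq {n : ℕ} {L : List (List ℕ)} (hL : L.Nodup)
    (hlen : ∀ l ∈ L, l.length = n) (i j : Fin L.length)
    (h : ∀ d ∈ Finset.Icc 1 n, startsOfList L[i] d = startsOfList L[j] d) : i = j :=
  Fin.ext ((hL.getElem_inj_iff).1 (eq_of_startsOfList_eq (hlen _ (List.getElem_mem _))
    (hlen _ (List.getElem_mem _)) h))

instance (n : ℕ) (a : ℕ → ℕ) : Decidable (IsSkolemStarts n a) :=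
  decidable_of_iff ((∀ d ∈ Finset.Icc 1 n, a d + d < 2 * n) ∧
    (∀ d ∈ Finset.Icc 1 n, ∀ e ∈ Finset.Icc 1 n, d ≠ e → a d ≠ a e) ∧
    (∀ d ∈ Finset.Icc 1 n, ∀ e ∈ Finset.Icc 1 n, d ≠ e → a d + d ≠ a e + e) ∧
    ∀ d ∈ Finset.Icc 1 n, ∀ e ∈ Finset.Icc 1 n, a d ≠ a e + e)
  ⟨fun ⟨h1, h2, h3, h4⟩ => ⟨h1, h2, h3, h4⟩, fun ⟨h1, h2, h3, h4⟩ => ⟨h1, h2, h3, h4⟩⟩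

instance (n t p q r s : ℕ) (a : ℕ → ℕ) : Decidable (IsExtendable n t p q r s a) :=
  decidable_of_iff (IsSkolemStarts n a ∧ ∀ d ∈ Finset.Icc 1 n, cutsBelow t p q r s (a d + d) =
    cutsBelow t p q r s (a d) + cutsBetween t d)
  ⟨fun ⟨h1, h2⟩ => ⟨h1, h2⟩, fun ⟨h1, h2⟩ => ⟨h1, h2⟩⟩

theorem length_le_card_isSkolemSeqF {n : ℕ} (L : List (List ℕ)) (hL : L.Nodup)
    (hlen : ∀ l ∈ L, l.length = n) (h : ∀ l ∈ L, IsSkolemStarts n (startsOfList l)) :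
    L.length ≤ Nat.card {s : Fin (2 * n) → ℕ // IsSkolemSeqF n s} := by
  simpa using card_le_card_isSkolemSeqF (fun i : Fin L.length => startsOfList L[i])
    (fun i => h _ (List.getElem_mem _)) (eq_of_startsOfList_getElem_eq hL hlen)

theorem hasExtendableFamily_of_list {n t p q r s : ℕ} (hcut : IsCutSystem n t p q r s)
    (L : List (List ℕ)) (hL : L.Nodup) (hlen : ∀ l ∈ L, l.length = n)
    (h : ∀ l ∈ L, IsExtendable n t p q r s (startsOfList l)) :
    HasExtendableFamily n t p q r s L.length :=
  ⟨hcut, Fin L.length, fun i => startsOfList L[i], by simp, fun i => h _ (List.getElem_mem _),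
    eq_of_startsOfList_getElem_eq hL hlen⟩

theorem hasExtendableFamily_eight : HasExtendableFamily 8 6 0 2 6 11 4 :=
  hasExtendableFamily_of_list (by constructor <;> decide)
    [[11, 13, 1, 2, 5, 3, 7, 0],
     [11, 13, 4, 2, 0, 8, 3, 1],
     [11, 13, 3, 0, 5, 2, 7, 1],
     [12, 4, 0, 11, 5, 2, 7, 1]]
    (by decide +kernel) (by decide +kernel) (by decide +kernel)

theorem hasExtendableFamily_nine : HasExtendableFamily 9 7 0 3 8 13 8 :=
  hasExtendableFamily_of_list (by constructor <;> decide)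
    [[14, 2, 5, 12, 1, 7, 10, 3, 0],
     [14, 1, 5, 2, 11, 7, 10, 4, 0],
     [13, 2, 5, 12, 1, 11, 3, 7, 0],
     [13, 1, 5, 2, 12, 10, 4, 7, 0],
     [13, 1, 2, 4, 11, 6, 10, 7, 0],
     [14, 1, 2, 6, 12, 7, 4, 8, 0],
     [14, 6, 2, 0, 12, 7, 9, 3, 1],
     [13, 6, 0, 1, 12, 4, 9, 7, 2]]
    (by decide +kernel) (by decide +kernel) (by decide +kernel)

theorem hasExtendableFamily_twelve : HasExtendableFamily 12 4 3 6 12 16 16 :=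
  hasExtendableFamily_of_list (by constructor <;> decide)
    [[12, 4, 16, 17, 18, 1, 2, 0, 5, 10, 11, 3],
     [12, 4, 16, 17, 18, 2, 0, 1, 5, 10, 11, 3],
     [14, 4, 16, 17, 18, 1, 2, 5, 3, 0, 11, 8],
     [14, 4, 16, 17, 18, 1, 5, 2, 0, 3, 11, 8],
     [13, 17, 3, 16, 18, 2, 0, 4, 1, 5, 11, 9],
     [12, 4, 16, 17, 18, 1, 2, 0, 11, 5, 3, 10],
     [12, 4, 16, 17, 18, 2, 0, 1, 11, 5, 3, 10],
     [12, 17, 3, 16, 18, 1, 2, 0, 5, 11, 4, 10],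
     [12, 17, 3, 16, 18, 2, 0, 1, 5, 11, 4, 10],
     [14, 4, 16, 17, 18, 2, 0, 5, 3, 1, 9, 10],
     [14, 4, 16, 17, 18, 1, 5, 0, 2, 3, 9, 10],
     [12, 4, 17, 18, 16, 1, 2, 0, 10, 5, 3, 11],
     [12, 4, 18, 16, 17, 1, 2, 0, 10, 5, 3, 11],
     [12, 4, 17, 18, 16, 2, 0, 1, 10, 5, 3, 11],
     [12, 4, 18, 16, 17, 2, 0, 1, 10, 5, 3, 11],
     [12, 17, 3, 18, 16, 1, 2, 0, 5, 10, 4, 11]]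
    (by decide +kernel) (by decide +kernel) (by decide +kernel)

theorem hasExtendableFamily_thirteen : HasExtendableFamily 13 3 3 6 12 15 16 :=
  hasExtendableFamily_of_list (by constructor <;> decide)
    [[24, 16, 17, 15, 1, 2, 0, 4, 5, 3, 10, 11, 9],
     [24, 17, 15, 16, 1, 2, 0, 4, 5, 3, 10, 11, 9],
     [24, 16, 17, 15, 2, 0, 1, 4, 5, 3, 10, 11, 9],
     [24, 17, 15, 16, 2, 0, 1, 4, 5, 3, 10, 11, 9],
     [24, 16, 17, 15, 1, 2, 0, 5, 3, 4, 10, 11, 9],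
     [24, 17, 15, 16, 1, 2, 0, 5, 3, 4, 10, 11, 9],
     [24, 16, 17, 15, 2, 0, 1, 5, 3, 4, 10, 11, 9],
     [24, 17, 15, 16, 2, 0, 1, 5, 3, 4, 10, 11, 9],
     [24, 16, 17, 15, 1, 2, 0, 4, 5, 3, 11, 9, 10],
     [24, 17, 15, 16, 1, 2, 0, 4, 5, 3, 11, 9, 10],
     [24, 16, 17, 15, 2, 0, 1, 4, 5, 3, 11, 9, 10],
     [24, 17, 15, 16, 2, 0, 1, 4, 5, 3, 11, 9, 10],
     [24, 16, 17, 15, 1, 2, 0, 5, 3, 4, 11, 9, 10],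
     [24, 17, 15, 16, 1, 2, 0, 5, 3, 4, 11, 9, 10],
     [24, 16, 17, 15, 2, 0, 1, 5, 3, 4, 11, 9, 10],
     [24, 17, 15, 16, 2, 0, 1, 5, 3, 4, 11, 9, 10]]
    (by decide +kernel) (by decide +kernel) (by decide +kernel)

theorem hasExtendableFamily_sixteen : HasExtendableFamily 16 6 5 9 18 23 32 :=
  hasExtendableFamily_of_list (by constructor <;> decide)
    [[18, 8, 6, 22, 24, 25, 23, 3, 4, 2, 17, 15, 1, 7, 5, 0],
     [18, 8, 6, 22, 25, 23, 24, 3, 4, 2, 17, 15, 1, 7, 5, 0],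
     [18, 8, 6, 22, 24, 25, 23, 4, 2, 3, 17, 15, 1, 7, 5, 0],
     [18, 8, 6, 22, 25, 23, 24, 4, 2, 3, 17, 15, 1, 7, 5, 0],
     [18, 8, 6, 22, 24, 25, 23, 4, 2, 17, 3, 1, 15, 7, 5, 0],
     [18, 8, 6, 22, 25, 23, 24, 4, 2, 17, 3, 1, 15, 7, 5, 0],
     [18, 8, 6, 22, 24, 25, 23, 3, 4, 17, 1, 2, 15, 7, 5, 0],
     [18, 8, 6, 22, 25, 23, 24, 3, 4, 17, 1, 2, 15, 7, 5, 0],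
     [21, 7, 24, 6, 23, 25, 19, 4, 2, 8, 3, 1, 17, 15, 5, 0],
     [21, 7, 24, 6, 23, 25, 19, 3, 4, 8, 1, 2, 17, 15, 5, 0],
     [21, 8, 6, 24, 25, 23, 19, 3, 4, 2, 7, 15, 1, 17, 5, 0],
     [21, 8, 6, 25, 23, 24, 19, 3, 4, 2, 7, 15, 1, 17, 5, 0],
     [21, 8, 6, 24, 25, 23, 19, 4, 2, 3, 7, 15, 1, 17, 5, 0],
     [21, 8, 6, 25, 23, 24, 19, 4, 2, 3, 7, 15, 1, 17, 5, 0],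
     [21, 7, 24, 6, 25, 23, 19, 4, 2, 8, 3, 1, 15, 17, 5, 0],
     [21, 7, 24, 6, 25, 23, 19, 3, 4, 8, 1, 2, 15, 17, 5, 0],
     [19, 7, 24, 22, 5, 25, 23, 3, 4, 8, 1, 17, 2, 14, 6, 0],
     [18, 7, 24, 22, 5, 25, 23, 3, 4, 2, 17, 8, 1, 15, 6, 0],
     [18, 7, 24, 22, 5, 25, 23, 4, 2, 3, 17, 8, 1, 15, 6, 0],
     [19, 8, 24, 5, 21, 25, 23, 3, 4, 2, 17, 6, 1, 15, 7, 0],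
     [19, 8, 24, 5, 21, 25, 23, 4, 2, 3, 17, 6, 1, 15, 7, 0],
     [19, 8, 6, 24, 21, 25, 23, 4, 2, 17, 3, 1, 5, 15, 7, 0],
     [19, 8, 6, 24, 21, 25, 23, 3, 4, 17, 1, 2, 5, 15, 7, 0],
     [20, 8, 6, 22, 24, 25, 23, 4, 2, 17, 3, 7, 5, 1, 13, 0],
     [20, 8, 6, 22, 25, 23, 24, 4, 2, 17, 3, 7, 5, 1, 13, 0],
     [20, 7, 24, 22, 5, 25, 23, 4, 2, 8, 3, 17, 6, 1, 13, 0],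
     [20, 25, 6, 22, 5, 23, 24, 4, 2, 8, 3, 7, 17, 1, 13, 0],
     [20, 8, 6, 22, 24, 25, 23, 4, 2, 17, 7, 3, 1, 5, 13, 0],
     [20, 8, 6, 22, 25, 23, 24, 4, 2, 17, 7, 3, 1, 5, 13, 0],
     [21, 8, 6, 23, 25, 20, 24, 3, 4, 2, 17, 7, 5, 1, 14, 0],
     [21, 8, 6, 23, 25, 20, 24, 4, 2, 3, 17, 7, 5, 1, 14, 0],
     [19, 7, 24, 22, 5, 25, 23, 3, 4, 2, 17, 6, 8, 1, 14, 0]]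
    (by decide +kernel) (by decide +kernel) (by decide +kernel)

theorem hasExtendableFamily_seventeen : HasExtendableFamily 17 6 6 10 20 25 32 :=
  hasExtendableFamily_of_list (by constructor <;> decide)
    [[22, 9, 7, 24, 26, 27, 25, 4, 5, 3, 19, 8, 16, 1, 6, 2, 0],
     [22, 9, 7, 24, 27, 25, 26, 4, 5, 3, 19, 8, 16, 1, 6, 2, 0],
     [22, 9, 7, 24, 26, 27, 25, 5, 3, 4, 19, 8, 16, 1, 6, 2, 0],
     [22, 9, 7, 24, 27, 25, 26, 5, 3, 4, 19, 8, 16, 1, 6, 2, 0],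
     [22, 9, 7, 24, 26, 27, 25, 5, 3, 19, 4, 8, 1, 16, 6, 2, 0],
     [22, 9, 7, 24, 27, 25, 26, 5, 3, 19, 4, 8, 1, 16, 6, 2, 0],
     [22, 8, 26, 24, 6, 27, 25, 4, 5, 3, 19, 9, 7, 1, 16, 2, 0],
     [22, 8, 26, 24, 6, 27, 25, 5, 3, 4, 19, 9, 7, 1, 16, 2, 0],
     [23, 9, 7, 25, 26, 27, 21, 4, 5, 3, 19, 8, 2, 18, 1, 6, 0],
     [23, 9, 7, 25, 26, 27, 21, 5, 3, 4, 19, 8, 2, 18, 1, 6, 0],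
     [23, 8, 26, 7, 25, 27, 21, 4, 5, 3, 9, 19, 2, 18, 1, 6, 0],
     [23, 8, 26, 7, 25, 27, 21, 5, 3, 4, 9, 19, 2, 18, 1, 6, 0],
     [23, 9, 7, 26, 27, 25, 21, 4, 5, 3, 18, 8, 2, 19, 1, 6, 0],
     [23, 9, 7, 27, 25, 26, 21, 4, 5, 3, 18, 8, 2, 19, 1, 6, 0],
     [23, 9, 7, 26, 27, 25, 21, 5, 3, 4, 18, 8, 2, 19, 1, 6, 0],
     [23, 9, 7, 27, 25, 26, 21, 5, 3, 4, 18, 8, 2, 19, 1, 6, 0],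
     [23, 8, 26, 7, 27, 25, 21, 4, 5, 3, 9, 18, 2, 19, 1, 6, 0],
     [23, 8, 26, 7, 27, 25, 21, 5, 3, 4, 9, 18, 2, 19, 1, 6, 0],
     [20, 9, 7, 24, 26, 27, 25, 4, 5, 19, 2, 18, 3, 1, 8, 6, 0],
     [20, 9, 7, 24, 27, 25, 26, 4, 5, 19, 2, 18, 3, 1, 8, 6, 0],
     [20, 9, 7, 24, 26, 27, 25, 5, 3, 19, 4, 18, 1, 2, 8, 6, 0],
     [20, 9, 7, 24, 27, 25, 26, 5, 3, 19, 4, 18, 1, 2, 8, 6, 0],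
     [23, 9, 7, 26, 27, 25, 21, 4, 5, 19, 2, 8, 3, 1, 18, 6, 0],
     [23, 9, 7, 27, 25, 26, 21, 4, 5, 19, 2, 8, 3, 1, 18, 6, 0],
     [23, 9, 7, 26, 27, 25, 21, 5, 3, 19, 4, 8, 1, 2, 18, 6, 0],
     [23, 9, 7, 27, 25, 26, 21, 5, 3, 19, 4, 8, 1, 2, 18, 6, 0],
     [20, 8, 27, 24, 6, 25, 26, 5, 3, 19, 4, 2, 9, 18, 1, 7, 0],
     [20, 8, 27, 24, 6, 25, 26, 4, 5, 19, 2, 3, 9, 18, 1, 7, 0],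
     [21, 9, 7, 26, 23, 27, 25, 4, 5, 3, 18, 19, 2, 6, 1, 8, 0],
     [21, 9, 7, 26, 23, 27, 25, 5, 3, 4, 18, 19, 2, 6, 1, 8, 0],
     [21, 9, 7, 26, 23, 27, 25, 5, 3, 19, 4, 2, 18, 6, 1, 8, 0],
     [21, 9, 7, 26, 23, 27, 25, 4, 5, 19, 2, 3, 18, 6, 1, 8, 0]]
    (by decide +kernel) (by decide +kernel) (by decide +kernel)

/-- If `n ≥ 1` and `n ≡ 0` or `1 (mod 4)`, then the number of Skolem sequences of
order `n` is at least `2 ^ ⌊n / 3⌋`. -/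
theorem skolem_lower_bound (n : ℕ) (hn : 1 ≤ n) (h : n % 4 = 0 ∨ n % 4 = 1) :
    2 ^ (n / 3) ≤ Nat.card {s : Fin (2 * n) → ℕ // IsSkolemSeqF n s} := by
  have pow_mul_le {n₀ e k t p q r s : ℕ} (hf : HasExtendableFamily n₀ t p q r s (2 ^ e))
      (hn : n = n₀ + 12 * k) (he : e = n₀ / 3) :
      2 ^ (n / 3) ≤ Nat.card {s : Fin (2 * n) → ℕ // IsSkolemSeqF n s} := by
    have hdiv : n / 3 = e + 4 * k := by omega
    rw [hdiv, pow_add, pow_mul]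
    subst hn
    exact (hf.extend_iterate k).le_card
  by_cases h1 : n = 1
  · subst h1
    exact length_le_card_isSkolemSeqF [[0]] (by decide) (by decide) (by decide)
  by_cases h4 : n = 4
  · subst h4
    exact length_le_card_isSkolemSeqF [[0, 3, 4, 2], [6, 2, 0, 1]]
      (by decide) (by decide) (by decide)
  by_cases h5 : n = 5
  · subst h5
    exact length_le_card_isSkolemSeqF [[2, 7, 5, 0, 1], [6, 0, 1, 5, 3]]
      (by decide) (by decide) (by decide)
  obtain ⟨k, hk⟩ | ⟨k, hk⟩ | ⟨k, hk⟩ | ⟨k, hk⟩ | ⟨k, hk⟩ | ⟨k, hk⟩ :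
      (∃ k, n = 8 + 12 * k) ∨ (∃ k, n = 9 + 12 * k) ∨ (∃ k, n = 12 + 12 * k) ∨
      (∃ k, n = 13 + 12 * k) ∨ (∃ k, n = 16 + 12 * k) ∨ (∃ k, n = 17 + 12 * k) := by
    have hmod : n % 12 = 8 ∨ n % 12 = 9 ∨ n % 12 = 0 ∨ n % 12 = 1 ∨ n % 12 = 4 ∨ n % 12 = 5 := by
      omega
    rcases hmod with hm | hm | hm | hm | hm | hm
    · exact .inl ⟨(n - 8) / 12, by omega⟩
    · exact .inr (.inl ⟨(n - 9) / 12, by omega⟩)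
    · exact .inr (.inr (.inl ⟨(n - 12) / 12, by omega⟩))
    · exact .inr (.inr (.inr (.inl ⟨(n - 13) / 12, by omega⟩)))
    · exact .inr (.inr (.inr (.inr (.inl ⟨(n - 16) / 12, by omega⟩))))
    · exact .inr (.inr (.inr (.inr (.inr ⟨(n - 17) / 12, by omega⟩))))
  · exact pow_mul_le (e := 2) hasExtendableFamily_eight hk rfl
  · exact pow_mul_le (e := 3) hasExtendableFamily_nine hk rfl
  · exact pow_mul_le (e := 4) hasExtendableFamily_twelve hk rfl
  · exact pow_mul_le (e := 4) hasExtendableFamily_thirteen hk rfl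
  · exact pow_mul_le (e := 5) hasExtendableFamily_sixteen hk rfl
  · exact pow_mul_le (e := 5) hasExtendableFamily_seventeen hk rfl
end

section
/- There are exactly 504 Skolem sequences of order 8; that is, the number of sequences (s_1, …, s_16) of positive integers with every entry in {1,…,8} such that every k ∈ {1,…,8} occurs at exactly two positions i < j with j − i = k, equals 504. -/
/-- The sum `f 0 + ⋯ + f (n - 1)`, in a form the kernel evaluates quickly. -/
def sumBelow (f : ℕ → ℕ) : ℕ → ℕ
  | 0 => 0
  | n + 1 => Nat.add (f n) (sumBelow f n)

lemma sumBelow_eq_sum_range (f : ℕ → ℕ) (n : ℕ) : sumBelow f n = ∑ i ∈ Finset.range n, f i := by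
  induction n with
  | zero => rfl
  | succ n ih =>
    rw [Finset.sum_range_succ, ← ih]
    exact Nat.add_comm _ _

/-- The bitmask of the two positions `i` and `i + d`. -/
def pairMask (d i : ℕ) : ℕ := Nat.shiftLeft (Nat.succ (Nat.pow 2 d)) i

/-- The number of ways to place the differences `1, …, k` on `N` positions, none of the
positions whose bit is set in `m` being available. -/
def placementCount (N : ℕ) : ℕ → ℕ → ℕ
  | 0, _ => 1
  | k + 1, m => sumBelow (fun i =>
      match Nat.land m (pairMask (Nat.succ k) i) with
      | 0 => placementCount N k (Nat.lor m (pairMask (Nat.succ k) i))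
      | _ + 1 => 0) (Nat.sub N (Nat.succ k))

lemma placementCount_succ (N k m : ℕ) :
    placementCount N (k + 1) m = ∑ i ∈ Finset.range (N - (k + 1)),
      if m &&& pairMask (k + 1) i = 0 then placementCount N k (m ||| pairMask (k + 1) i) else 0 := by
  rw [placementCount, sumBelow_eq_sum_range]
  refine Finset.sum_congr rfl fun i _ => ?_
  change (match m &&& pairMask (k + 1) i with
    | 0 => placementCount N k (m ||| pairMask (k + 1) i)
    | _ + 1 => 0) = _
  split <;> simp_all

lemma testBit_pairMask {d : ℕ} (hd : 0 < d) (i x : ℕ) :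
    (pairMask d i).testBit x = true ↔ x ∈ ({i, i + d} : Set ℕ) := by
  have h : pairMask d i = (2 ^ d ||| 1) <<< i := by
    have := Nat.two_pow_add_eq_or_of_lt (Nat.one_lt_two_pow hd.ne') 1
    rw [mul_one] at this
    rw [← this]
    rfl
  simp only [h, Nat.testBit_shiftLeft, Nat.testBit_or, Nat.testBit_two_pow,
    Nat.testBit_one_eq_true_iff_self_eq_zero,
    Bool.and_eq_true, Bool.or_eq_true, decide_eq_true_eq, Set.mem_insert_iff, Set.mem_singleton_iff]
  omega

/-- The set of positions whose bit is set in `m`. -/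
def bitSet (m : ℕ) : Set ℕ := {x | m.testBit x = true}

lemma bitSet_zero : bitSet 0 = ∅ := by simp [bitSet]

lemma bitSet_or_pairMask {d : ℕ} (hd : 0 < d) (m i : ℕ) :
    bitSet (m ||| pairMask d i) = bitSet m ∪ {i, i + d} := by
  ext x
  simp only [bitSet, Set.mem_ofPred_eq, Nat.testBit_or, Bool.or_eq_true, testBit_pairMask hd,
    Set.mem_union]

lemma and_pairMask_eq_zero {d : ℕ} (hd : 0 < d) (m i : ℕ) :
    m &&& pairMask d i = 0 ↔ Disjoint ({i, i + d} : Set ℕ) (bitSet m) := by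
  rw [Set.disjoint_left]
  constructor
  · intro h x hx hm
    have hb := congrArg (Nat.testBit · x) h
    simp only [Nat.testBit_and, Nat.zero_testBit, (testBit_pairMask hd i x).2 hx] at hb
    simp_all [bitSet]
  · intro h
    refine Nat.eq_of_testBit_eq fun x => ?_
    rw [Nat.testBit_and, Nat.zero_testBit, Bool.eq_false_iff]
    intro hx
    rw [Bool.and_eq_true, testBit_pairMask hd] at hx
    exact h hx.2 hx.1

/-- `a` places each difference `j + 1` with `j < k` on the positions `a j` and `a j + (j + 1)`
among `0, …, N - 1`, all these positions being distinct and outside `S`. -/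
structure IsPlacement (N k : ℕ) (S : Set ℕ) (a : Fin k → ℕ) : Prop where
  lt : ∀ j : Fin k, a j + (j + 1) < N
  disjoint : ∀ j : Fin k, Disjoint ({a j, a j + (j + 1)} : Set ℕ) S
  pairwise : ∀ i j : Fin k, i ≠ j →
    Disjoint ({a i, a i + (i + 1)} : Set ℕ) {a j, a j + (j + 1)}

lemma isPlacement_snoc {N k : ℕ} {S : Set ℕ} {a : Fin k → ℕ} {i : ℕ} :
    IsPlacement N (k + 1) S (Fin.snoc a i : Fin (k + 1) → ℕ) ↔
      i < N - (k + 1) ∧ Disjoint ({i, i + (k + 1)} : Set ℕ) S ∧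
        IsPlacement N k (S ∪ {i, i + (k + 1)}) a := by
  constructor
  · rintro ⟨hlt, hdis, hpair⟩
    refine ⟨by have := hlt (Fin.last k); simp at this; omega,
      by simpa using hdis (Fin.last k), fun j => by simpa using hlt j.castSucc, fun j => ?_,
      fun j j' h => by
        simpa using hpair j.castSucc j'.castSucc (by simpa using h)⟩
    rw [Set.disjoint_union_right]
    exact ⟨by simpa using hdis j.castSucc,
      by simpa using hpair j.castSucc (Fin.last k) (Fin.castSucc_lt_last j).ne⟩
  · rintro ⟨hi, hS, hlt, hdis, hpair⟩
    simp only [Set.disjoint_union_right] at hdis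
    refine ⟨fun j => ?_, fun j => ?_, fun j j' h => ?_⟩
    · induction j using Fin.lastCases with
      | last => simp; omega
      | cast j => simpa using hlt j
    · induction j using Fin.lastCases with
      | last => simpa using hS
      | cast j => simpa using (hdis j).1
    · induction j using Fin.lastCases with
      | last =>
        induction j' using Fin.lastCases with
        | last => exact absurd rfl h
        | cast j' => simpa using (hdis j').2.symm
      | cast j =>
        induction j' using Fin.lastCases with
        | last => simpa using (hdis j).2
        | cast j' => simpa using hpair j j' (by simpa using h)

instance (N k : ℕ) (S : Set ℕ) : Finite {a : Fin k → ℕ // IsPlacement N k S a} := by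
  refine Finite.of_injective
    (fun a j => (⟨a.1 j, by have := a.2.lt j; omega⟩ : Fin N) : _ → Fin k → Fin N) ?_
  intro a b h
  ext j
  simpa using congrFun h j

/-- A position for `k + 1` together with a placement of `1, …, k` on the remaining positions,
seen as a placement of `1, …, k + 1`. -/
def snocPlacement (N k : ℕ) (S : Set ℕ)
    (p : Σ i : Fin (N - (k + 1)), {a : Fin k → ℕ // Disjoint ({(i : ℕ), i + (k + 1)} : Set ℕ) S ∧
      IsPlacement N k (S ∪ {(i : ℕ), i + (k + 1)}) a}) :
    {a : Fin (k + 1) → ℕ // IsPlacement N (k + 1) S a} :=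
  ⟨Fin.snoc p.2.1 (p.1 : ℕ), isPlacement_snoc.2 ⟨p.1.2, p.2.2⟩⟩

lemma snocPlacement_bijective (N k : ℕ) (S : Set ℕ) :
    Function.Bijective (snocPlacement N k S) := by
  constructor
  · rintro ⟨i, a, ha⟩ ⟨j, b, hb⟩ h
    obtain ⟨rfl, hij⟩ := Fin.snoc_injective2 (α := fun _ => ℕ) (congrArg Subtype.val h)
    obtain rfl := Fin.ext hij
    rfl
  · rintro ⟨a, ha⟩
    have h := isPlacement_snoc.1 ((Fin.snoc_init_self a).symm ▸ ha)
    exact ⟨⟨⟨a (Fin.last k), h.1⟩, Fin.init a, h.2⟩, Subtype.ext (Fin.snoc_init_self a)⟩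

theorem card_isPlacement (N k m : ℕ) :
    Nat.card {a : Fin k → ℕ // IsPlacement N k (bitSet m) a} = placementCount N k m := by
  induction k generalizing m with
  | zero =>
    rw [placementCount, Nat.card_eq_one_iff_unique]
    exact ⟨inferInstance, ⟨Fin.elim0, fun j => j.elim0, fun j => j.elim0, fun j => j.elim0⟩⟩
  | succ k ih =>
    have hfin (i : Fin (N - (k + 1))) : Finite {a : Fin k → ℕ //
        Disjoint ({(i : ℕ), i + (k + 1)} : Set ℕ) (bitSet m) ∧
          IsPlacement N k (bitSet m ∪ {(i : ℕ), i + (k + 1)}) a} :=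
      Finite.of_injective _ (Subtype.map_injective (fun _ h => h.2) Function.injective_id)
    rw [← Nat.card_eq_of_bijective _ (snocPlacement_bijective N k _), Nat.card_sigma,
      placementCount_succ,
      ← Fin.sum_univ_eq_sum_range (fun i => if m &&& pairMask (k + 1) i = 0 then
        placementCount N k (m ||| pairMask (k + 1) i) else 0)]
    refine Finset.sum_congr rfl fun i _ => ?_
    split_ifs with h
    · rw [and_pairMask_eq_zero k.succ_pos] at h
      rw [← ih, bitSet_or_pairMask k.succ_pos]
      simp only [h, true_and]
    · rw [and_pairMask_eq_zero k.succ_pos] at h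
      simp [h]

/-- The two positions carrying `j + 1` in a placement of all differences `1, …, n`. -/
def placementPos {n : ℕ} {a : Fin n → ℕ} (ha : IsPlacement (2 * n) n ∅ a) (p : Fin n × Bool) :
    Fin (2 * n) :=
  ⟨a p.1 + (bif p.2 then (p.1 : ℕ) + 1 else 0), by have := ha.lt p.1; cases p.2 <;> simp <;> omega⟩

lemma placementPos_bijective {n : ℕ} {a : Fin n → ℕ} (ha : IsPlacement (2 * n) n ∅ a) :
    Function.Bijective (placementPos ha) := by
  rw [Fintype.bijective_iff_injective_and_card]
  refine ⟨?_, by simp [mul_comm]⟩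
  rintro ⟨i, b⟩ ⟨j, c⟩ h
  have h : a i + (bif b then (i : ℕ) + 1 else 0) = a j + (bif c then (j : ℕ) + 1 else 0) :=
    congrArg Fin.val h
  have hij : i = j := by
    by_contra hij
    have hi : a i + (bif b then (i : ℕ) + 1 else 0) ∈ ({a i, a i + (i + 1)} : Set ℕ) := by
      cases b <;> simp
    have hj : a j + (bif c then (j : ℕ) + 1 else 0) ∈ ({a j, a j + (j + 1)} : Set ℕ) := by
      cases c <;> simp
    exact Set.disjoint_left.1 (ha.pairwise i j hij) hi (h ▸ hj)
  subst hij
  cases b <;> cases c <;> simp_all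

/-- The sequence `s` carries each value `j + 1` on the positions `a j` and `a j + (j + 1)`. -/
def IsStartOf {n : ℕ} (s : Fin (2 * n) → ℕ) (a : Fin n → ℕ) : Prop :=
  ∀ j : Fin n, ∃ x y : Fin (2 * n), (x : ℕ) = a j ∧ (y : ℕ) = a j + (j + 1) ∧
    s x = j + 1 ∧ s y = j + 1

lemma IsSkolemSeqF.exists_isStartOf {n : ℕ} {s : Fin (2 * n) → ℕ} (hs : IsSkolemSeqF n s) :
    ∃ a, IsStartOf s a := by
  have h (j : Fin n) : ∃ i : ℕ, ∃ x y : Fin (2 * n), (x : ℕ) = i ∧ (y : ℕ) = i + (j + 1) ∧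
      s x = j + 1 ∧ s y = j + 1 := by
    obtain ⟨x, y, hxy, he⟩ := Finset.card_eq_two.1 (hs.2.1 (j + 1) (by simp))
    have hx : s x = j + 1 := by simpa using (Finset.ext_iff.1 he x).2 (by simp)
    have hy : s y = j + 1 := by simpa using (Finset.ext_iff.1 he y).2 (by simp)
    rcases lt_or_gt_of_ne hxy with h | h
    · have := hs.2.2 x y h (hx.trans hy.symm)
      exact ⟨x, x, y, rfl, by omega, hx, hy⟩
    · have := hs.2.2 y x h (hy.trans hx.symm)
      exact ⟨y, y, x, rfl, by omega, hy, hx⟩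
  choose a ha using h
  exact ⟨a, ha⟩

lemma IsStartOf.isPlacement {n : ℕ} {s : Fin (2 * n) → ℕ} {a : Fin n → ℕ}
    (ha : IsStartOf s a) : IsPlacement (2 * n) n ∅ a := by
  have key (j : Fin n) (z : ℕ) (hz : z ∈ ({a j, a j + (j + 1)} : Set ℕ)) :
      ∃ x : Fin (2 * n), (x : ℕ) = z ∧ s x = j + 1 := by
    obtain ⟨x, y, hx, hy, hsx, hsy⟩ := ha j
    rcases hz with rfl | rfl
    exacts [⟨x, hx, hsx⟩, ⟨y, hy, hsy⟩]
  refine ⟨fun j => ?_, fun j => Set.disjoint_empty _, fun i j hij => ?_⟩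
  · obtain ⟨x, y, -, hy, -⟩ := ha j
    omega
  · refine Set.disjoint_left.2 fun z hi hj => hij ?_
    obtain ⟨x, hx, hsx⟩ := key i z hi
    obtain ⟨y, hy, hsy⟩ := key j z hj
    obtain rfl : x = y := Fin.ext (hx.trans hy.symm)
    exact Fin.ext (by omega)

lemma IsStartOf.apply_placementPos {n : ℕ} {s : Fin (2 * n) → ℕ} {a : Fin n → ℕ}
    (h : IsStartOf s a) (ha : IsPlacement (2 * n) n ∅ a) (p : Fin n × Bool) :
    s (placementPos ha p) = p.1 + 1 := by
  obtain ⟨j, b⟩ := p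
  obtain ⟨x, y, hx, hy, hsx, hsy⟩ := h j
  cases b
  · rw [← hsx]
    exact congrArg s (Fin.ext (by simp [placementPos, hx]))
  · rw [← hsy]
    exact congrArg s (Fin.ext (by simp [placementPos, hy]))

lemma IsStartOf.eq_left {n : ℕ} {s t : Fin (2 * n) → ℕ} {a : Fin n → ℕ}
    (hs : IsStartOf s a) (ht : IsStartOf t a) : s = t := by
  have ha := hs.isPlacement
  ext z
  obtain ⟨p, rfl⟩ := (placementPos_bijective ha).2 z
  rw [hs.apply_placementPos, ht.apply_placementPos]

lemma IsStartOf.eq_right {n : ℕ} {s : Fin (2 * n) → ℕ} {a b : Fin n → ℕ}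
    (hs : IsSkolemSeqF n s) (ha : IsStartOf s a) (hb : IsStartOf s b) : a = b := by
  have key (a b : Fin n → ℕ) (ha : IsStartOf s a) (hb : IsStartOf s b) (j : Fin n) :
      ¬ a j < b j := by
    intro h
    obtain ⟨x, -, hx, -, hsx, -⟩ := ha j
    obtain ⟨x', y', hx', hy', hsx', hsy'⟩ := hb j
    have h1 := hs.2.2 x x' (Fin.lt_def.2 (by omega)) (by omega)
    have h2 := hs.2.2 x y' (Fin.lt_def.2 (by omega)) (by omega)
    omega
  ext j
  have := key a b ha hb j
  have := key b a hb ha j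
  omega

lemma IsPlacement.exists_isSkolemSeqF {n : ℕ} {a : Fin n → ℕ}
    (ha : IsPlacement (2 * n) n ∅ a) : ∃ s, IsSkolemSeqF n s ∧ IsStartOf s a := by
  let e := Equiv.ofBijective _ (placementPos_bijective ha)
  have hval (j : Fin n) (b : Bool) : (e (j, b) : ℕ) = a j + (bif b then (j : ℕ) + 1 else 0) := rfl
  refine ⟨fun x => (e.symm x).1 + 1, ⟨fun x => by simp, fun k hk => ?_, ?_⟩, fun j => ?_⟩
  · obtain ⟨hk1, hkn⟩ := Finset.mem_Icc.1 hk
    refine Finset.card_eq_two.2 ⟨e (⟨k - 1, by omega⟩, false), e (⟨k - 1, by omega⟩, true),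
      by simp, ?_⟩
    ext x
    obtain ⟨⟨j, b⟩, rfl⟩ := e.surjective x
    cases b <;> simp [Fin.ext_iff] <;> omega
  · intro x y
    obtain ⟨⟨i, b⟩, rfl⟩ := e.surjective x
    obtain ⟨⟨j, c⟩, rfl⟩ := e.surjective y
    intro hlt hij
    obtain rfl : i = j := Fin.ext (by simpa using hij)
    rw [Fin.lt_def] at hlt
    simp only [hval, Equiv.symm_apply_apply] at hlt ⊢
    cases b <;> cases c <;> simp at hlt ⊢
  · exact ⟨e (j, false), e (j, true), by simp [hval], by simp [hval], by simp, by simp⟩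

theorem card_isSkolemSeqF (n : ℕ) :
    Nat.card {s : Fin (2 * n) → ℕ // IsSkolemSeqF n s} = placementCount (2 * n) n 0 := by
  rw [← card_isPlacement, bitSet_zero]
  choose f hf using fun s : {s : Fin (2 * n) → ℕ // IsSkolemSeqF n s} => s.2.exists_isStartOf
  refine Nat.card_eq_of_bijective (fun s => ⟨f s, (hf s).isPlacement⟩) ⟨?_, ?_⟩
  · intro s t h
    have h : f s = f t := congrArg Subtype.val h
    exact Subtype.ext ((hf s).eq_left (h ▸ hf t))
  · rintro ⟨a, ha⟩
    obtain ⟨s, hs, hsa⟩ := ha.exists_isSkolemSeqF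
    exact ⟨⟨s, hs⟩, Subtype.ext (IsStartOf.eq_right hs (hf ⟨s, hs⟩) hsa)⟩

/-- There are exactly `504` Skolem sequences of order `8`. -/
theorem skolem_count_order_eight :
    Nat.card {s : Fin (2 * 8) → ℕ // IsSkolemSeqF 8 s} = 504 := by
  rw [card_isSkolemSeqF]
  decide +kernel
end
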